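/- Let (A_n) be an asymptotically regular sequence of symmetric matrices, let β ≥ 0, J = β·I_q (the q×q matrix with J(r,r)=β and J(r,s)=0 for r≠s), and h ∈ ℝ^q. Then lim_{n→∞} (1/n)·Φ_n = sup_{θ} [ (β/2)·Σ_{r=1}^q θ(r)² − Σ_{r=1}^q θ(r)·log θ(r) + Σ_{r=1}^q h(r)·θ(r) ], where the supremum is over all probability vectors θ on {1,…,q}. -/

import Mathlib

open Finset Filter Real

noncomputable def pottsH {n q : ℕ} (A : Matrix (Fin n) (Fin n) ℝ)
    (J : Matrix (Fin q) (Fin q) ℝ) (h : Fin q → ℝ) (y : Fin n → Fin q) : ℝ :=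
  (1 / 2) * ∑ i, ∑ j, A i j * J (y i) (y j) + ∑ i, h (y i)

noncomputable def pottsPhi {n q : ℕ} (A : Matrix (Fin n) (Fin n) ℝ)
    (J : Matrix (Fin q) (Fin q) ℝ) (h : Fin q → ℝ) : ℝ :=
  Real.log (∑ y : Fin n → Fin q, Real.exp (pottsH A J h y))

def probVec {q : ℕ} (θ : Fin q → ℝ) : Prop :=
  (∀ r, 0 ≤ θ r) ∧ ∑ r, θ r = 1

def meanFieldAssumption (A : (n : ℕ) → Matrix (Fin n) (Fin n) ℝ) : Prop :=
  (∃ C : ℝ, ∀ n : ℕ, ∀ x : Fin n → ℝ, (∀ j, x j ∈ Set.Icc (0:ℝ) 1) →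
      ∑ i, |∑ j, A n i j * x j| ≤ C * n) ∧
  Tendsto (fun n : ℕ => Matrix.trace (A n * A n) / n) atTop (nhds 0)

open scoped Classical in
/-- A sequence of symmetric matrices is asymptotically regular if it satisfies the
mean-field assumption, has nonnegative entries, the proportion of rows whose sum deviates
from 1 by more than δ vanishes, and the average row sum tends to 1. -/
def asympRegular (A : (n : ℕ) → Matrix (Fin n) (Fin n) ℝ) : Prop :=
  meanFieldAssumption A ∧
  (∀ n : ℕ, ∀ i j : Fin n, 0 ≤ A n i j) ∧
  (∀ δ : ℝ, 0 < δ →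
    Tendsto (fun n : ℕ =>
        ((Finset.univ.filter (fun i : Fin n => δ < |(∑ j, A n i j) - 1|)).card : ℝ) / n)
      atTop (nhds 0)) ∧
  Tendsto (fun n : ℕ => (∑ i, ∑ j, A n i j) / n) atTop (nhds 1)

/-- The Curie–Weiss mean-field value: the supremum over probability vectors on `[q]`. -/
noncomputable def curieWeissSup (q : ℕ) (β : ℝ) (h : Fin q → ℝ) : ℝ :=
  sSup {x | ∃ θ : Fin q → ℝ, probVec θ ∧
    x = (β / 2) * ∑ r, θ r ^ 2 - ∑ r, θ r * Real.log (θ r) + ∑ r, h r * θ r}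


lemma le_curieWeissSup {q : ℕ} {β : ℝ} {h θ : Fin q → ℝ} (hθ : probVec θ) :
    (β / 2) * ∑ r, θ r ^ 2 - ∑ r, θ r * Real.log (θ r) + ∑ r, h r * θ r
      ≤ curieWeissSup q β h := by
  refine le_csSup ⟨|β / 2| * q + q + ∑ r, |h r|, ?_⟩ ⟨θ, hθ, rfl⟩
  rintro x ⟨η, hη, rfl⟩
  have hle : ∀ r, η r ≤ 1 := fun r => by
    rw [← hη.2]
    exact Finset.single_le_sum (fun s _ => hη.1 s) (Finset.mem_univ r)
  have h1 : (β / 2) * ∑ r, η r ^ 2 ≤ |β / 2| * q := by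
    have hs : ∑ r, η r ^ 2 ≤ q := by
      calc ∑ r, η r ^ 2 ≤ ∑ _r : Fin q, (1 : ℝ) :=
            Finset.sum_le_sum fun r _ => pow_le_one₀ (hη.1 r) (hle r)
        _ = q := by simp
    have hs0 : 0 ≤ ∑ r, η r ^ 2 := Finset.sum_nonneg fun r _ => sq_nonneg _
    calc (β / 2) * ∑ r, η r ^ 2 ≤ |β / 2| * ∑ r, η r ^ 2 := by gcongr; exact le_abs_self _
      _ ≤ _ := by gcongr
  have h2 : -∑ r, η r * Real.log (η r) ≤ q := by
    rw [← Finset.sum_neg_distrib]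
    calc ∑ r, -(η r * Real.log (η r)) ≤ ∑ _r : Fin q, (1 : ℝ) := by
          refine Finset.sum_le_sum fun r _ => ?_
          rcases (hη.1 r).eq_or_lt with h0 | h0
          · simp [← h0]
          · have hl := Real.one_sub_inv_le_log_of_pos h0
            have := mul_le_mul_of_nonneg_left hl h0.le
            rw [mul_sub, mul_inv_cancel₀ h0.ne'] at this
            linarith
      _ = q := by simp
  have h3 : ∑ r, h r * η r ≤ ∑ r, |h r| := Finset.sum_le_sum fun r _ => by
    calc h r * η r ≤ |h r| * η r := by gcongr; exacts [hη.1 r, le_abs_self _]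
      _ ≤ |h r| * 1 := by gcongr; exact hle r
      _ = |h r| := mul_one _
  linarith

lemma probVec.sum_sq_le_one {q : ℕ} {θ : Fin q → ℝ} (hθ : probVec θ) : ∑ r, θ r ^ 2 ≤ 1 := by
  rw [← hθ.2]
  refine Finset.sum_le_sum fun r _ => ?_
  have : θ r ≤ 1 := by
    rw [← hθ.2]
    exact Finset.single_le_sum (fun s _ => hθ.1 s) (Finset.mem_univ r)
  nlinarith [hθ.1 r]

lemma curieWeissSup_le {q : ℕ} (hq : 0 < q) {β c : ℝ} {h : Fin q → ℝ}
    (H : ∀ θ, probVec θ →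
      (β / 2) * ∑ r, θ r ^ 2 - ∑ r, θ r * Real.log (θ r) + ∑ r, h r * θ r ≤ c) :
    curieWeissSup q β h ≤ c := by
  refine csSup_le ⟨_, Pi.single ⟨0, hq⟩ 1, ⟨fun r => ?_, ?_⟩, rfl⟩ ?_
  · by_cases hr : r = ⟨0, hq⟩ <;> simp [hr]
  · simp
  · rintro x ⟨θ, hθ, rfl⟩
    exact H θ hθ

lemma curieWeissSup_le_add {q : ℕ} (hq : 0 < q) {β b : ℝ} (hb : β ≤ b) (h : Fin q → ℝ) :
    curieWeissSup q b h ≤ curieWeissSup q β h + (b - β) / 2 := by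
  refine curieWeissSup_le hq fun θ hθ => ?_
  have h1 := le_curieWeissSup (β := β) (h := h) hθ
  have h2 := mul_le_mul_of_nonneg_left hθ.sum_sq_le_one (by linarith : 0 ≤ (b - β) / 2)
  nlinarith

lemma sum_exp_add_le {q : ℕ} (hq : 0 < q) {b : ℝ} (hb : 0 < b) (h z : Fin q → ℝ) :
    ∑ r, exp (z r + h r) ≤ exp ((∑ r, z r ^ 2) / (2 * b) + curieWeissSup q b h) := by
  have : Nonempty (Fin q) := ⟨⟨0, hq⟩⟩
  set Z := ∑ r, exp (z r + h r) with hZ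
  have hZ0 : 0 < Z := Finset.sum_pos (fun r _ => exp_pos _) Finset.univ_nonempty
  set θ : Fin q → ℝ := fun r => exp (z r + h r) / Z with hθdef
  have hθ : probVec θ :=
    ⟨fun r => by positivity, by simp only [hθdef, ← Finset.sum_div]; exact div_self hZ0.ne'⟩
  have hlog : ∀ r, Real.log (θ r) = z r + h r - Real.log Z := fun r => by
    rw [hθdef]
    simp only
    rw [Real.log_div (exp_pos _).ne' hZ0.ne', Real.log_exp]
  have key := le_curieWeissSup (β := b) (h := h) hθ
  have hent : ∑ r, θ r * Real.log (θ r)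
      = ∑ r, θ r * z r + ∑ r, h r * θ r - Real.log Z := by
    have : ∀ r, θ r * Real.log (θ r) = θ r * z r + h r * θ r - θ r * Real.log Z := fun r => by
      rw [hlog]; ring
    simp only [this, Finset.sum_sub_distrib, Finset.sum_add_distrib, ← Finset.sum_mul, hθ.2,
      one_mul]
  have hyoung : ∑ r, θ r * z r ≤ (∑ r, z r ^ 2) / (2 * b) + b / 2 * ∑ r, θ r ^ 2 := by
    rw [Finset.sum_div, Finset.mul_sum, ← Finset.sum_add_distrib]
    refine Finset.sum_le_sum fun r _ => ?_
    have : z r ^ 2 / (2 * b) + b / 2 * θ r ^ 2 - θ r * z r = (z r - b * θ r) ^ 2 / (2 * b) := by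
      field_simp; ring
    have : 0 ≤ (z r - b * θ r) ^ 2 / (2 * b) := by positivity
    linarith
  rw [← Real.log_le_iff_le_exp hZ0]
  linarith

open MeasureTheory in
lemma integral_exp_inner_sub_mul_sq_norm {V : Type*} [NormedAddCommGroup V]
    [InnerProductSpace ℝ V] [FiniteDimensional ℝ V] [MeasurableSpace V] [BorelSpace V]
    {p : ℝ} (hp : 0 < p) (w : V) :
    ∫ v : V, exp (inner ℝ w v - p * ‖v‖ ^ 2)
      = (π / p) ^ (Module.finrank ℝ V / 2 : ℝ) * exp (‖w‖ ^ 2 / (4 * p)) := by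
  have hsq : ∀ v : V, exp (inner ℝ w v - p * ‖v‖ ^ 2)
      = exp (-p * ‖v - (1 / (2 * p)) • w‖ ^ 2) * exp (‖w‖ ^ 2 / (4 * p)) := fun v => by
    rw [← exp_add, @norm_sub_sq_real, inner_smul_right, norm_smul, real_inner_comm,
      Real.norm_of_nonneg (by positivity)]
    congr 1
    field_simp
    ring
  simp only [hsq]
  rw [integral_mul_const, integral_sub_right_eq_self (fun v : V => exp (-p * ‖v‖ ^ 2)),
    GaussianFourier.integral_rexp_neg_mul_sq_norm hp]

open MeasureTheory in
lemma integrable_exp_inner_sub_mul_sq_norm {V : Type*} [NormedAddCommGroup V]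
    [InnerProductSpace ℝ V] [FiniteDimensional ℝ V] [MeasurableSpace V] [BorelSpace V]
    {p : ℝ} (hp : 0 < p) (w : V) :
    Integrable fun v : V => exp (inner ℝ w v - p * ‖v‖ ^ 2) := by
  refine Integrable.of_integral_ne_zero ?_
  rw [integral_exp_inner_sub_mul_sq_norm hp]
  positivity

open MeasureTheory in
lemma sum_exp_projection_le {n q : ℕ} (hq : 0 < q) {κ : Type*} [Fintype κ]
    (u : κ → Fin n × Fin q → ℝ)
    (hu : ∀ z : κ → ℝ, ∑ a, (∑ l, z l * u l a) ^ 2 = ∑ l, z l ^ 2)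
    (h : Fin q → ℝ) {b b' : ℝ} (hb : 0 < b) (hbb : b < b') :
    ∑ y : Fin n → Fin q, exp (b / 2 * ∑ l, (∑ i, u l (i, y i)) ^ 2 + ∑ i, h (y i))
      ≤ (b' / (b' - b)) ^ (Fintype.card κ / 2 : ℝ) * exp (n * curieWeissSup q b' h) := by
  have hb' : 0 < b' := hb.trans hbb
  set p : ℝ := 1 / (2 * b) with hpdef
  have hp : 0 < p := by positivity
  set t : ℝ := p - 1 / (2 * b') with htdef
  have ht : 0 < t := by
    rw [htdef, hpdef, sub_pos]
    gcongr
  set w : (Fin n → Fin q) → EuclideanSpace ℝ κ := fun y => WithLp.toLp 2 fun l => ∑ i, u l (i, y i) with hw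
  have hwn : ∀ y, ‖w y‖ ^ 2 = ∑ l, (∑ i, u l (i, y i)) ^ 2 := fun y => by
    rw [EuclideanSpace.real_norm_sq_eq]
  have hpt : ∀ v : EuclideanSpace ℝ κ, ∑ y, exp (inner ℝ (w y) v - p * ‖v‖ ^ 2) * exp (∑ i, h (y i))
      ≤ exp (inner ℝ (0 : EuclideanSpace ℝ κ) v - t * ‖v‖ ^ 2) * exp (n * curieWeissSup q b' h) := fun v => by
    have h1 : ∀ y, exp (inner ℝ (w y) v - p * ‖v‖ ^ 2) * exp (∑ i, h (y i))
        = exp (-p * ‖v‖ ^ 2) * ∏ i, exp (∑ l, v l * u l (i, y i) + h (y i)) := fun y => by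
      rw [← exp_sum, ← exp_add, ← exp_add]
      congr 1
      have : inner ℝ (w y) v = ∑ i, ∑ l, v l * u l (i, y i) := by
        rw [Finset.sum_comm]
        simp only [hw, PiLp.inner_apply, RCLike.inner_apply, conj_trivial,
          Finset.mul_sum]
      rw [this, Finset.sum_add_distrib]
      ring
    simp only [h1, ← Finset.mul_sum]
    rw [← Fintype.prod_sum (fun i r => exp (∑ l, v l * u l (i, r) + h r))]
    have h2 : ∏ i : Fin n, ∑ r, exp (∑ l, v l * u l (i, r) + h r)
        ≤ exp (‖v‖ ^ 2 / (2 * b') + n * curieWeissSup q b' h) := by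
      calc _ ≤ ∏ i : Fin n, exp ((∑ r, (∑ l, v l * u l (i, r)) ^ 2) / (2 * b')
              + curieWeissSup q b' h) :=
            Finset.prod_le_prod (fun i _ => Finset.sum_nonneg fun r _ => (exp_pos _).le)
              fun i _ => sum_exp_add_le hq hb' h _
        _ = _ := by
            rw [← exp_sum, Finset.sum_add_distrib, ← Finset.sum_div,
              ← Fintype.sum_prod_type' (fun i r => (∑ l, v l * u l (i, r)) ^ 2), hu,
              EuclideanSpace.real_norm_sq_eq]
            simp
    calc _ ≤ exp (-p * ‖v‖ ^ 2) * exp (‖v‖ ^ 2 / (2 * b') + n * curieWeissSup q b' h) := by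
          gcongr
      _ = _ := by
          rw [← exp_add, ← exp_add, inner_zero_left, htdef]
          congr 1
          ring
  have hint := integral_mono
    (integrable_finsetSum Finset.univ fun y _ =>
      (integrable_exp_inner_sub_mul_sq_norm hp (w y)).mul_const (exp (∑ i, h (y i))))
    ((integrable_exp_inner_sub_mul_sq_norm ht (0 : EuclideanSpace ℝ κ)).mul_const _) hpt
  rw [integral_finsetSum _ fun y _ =>
      (integrable_exp_inner_sub_mul_sq_norm hp (w y)).mul_const (exp (∑ i, h (y i)))] at hint
  simp only [integral_mul_const, integral_exp_inner_sub_mul_sq_norm hp,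
    integral_exp_inner_sub_mul_sq_norm ht, finrank_euclideanSpace] at hint
  have hc : 0 < (π / p) ^ (Fintype.card κ / 2 : ℝ) := by positivity
  have hratio : (π / t) ^ (Fintype.card κ / 2 : ℝ)
      = (π / p) ^ (Fintype.card κ / 2 : ℝ) * (b' / (b' - b)) ^ (Fintype.card κ / 2 : ℝ) := by
    have hd : 0 < b' - b := sub_pos.2 hbb
    rw [← Real.mul_rpow (by positivity) (by positivity)]
    congr 1
    have : t = p * ((b' - b) / b') := by
      rw [htdef, hpdef]; field_simp
    rw [this]
    field_simp
  rw [hratio] at hint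
  refine le_of_mul_le_mul_left ?_ hc
  calc _ = _ := ?_
    _ ≤ _ := hint
    _ = _ := by simp; ring
  rw [Finset.mul_sum]
  refine Finset.sum_congr rfl fun y _ => ?_
  rw [exp_add, hwn, ← mul_assoc]
  congr 3
  rw [hpdef]
  field_simp
  ring

lemma exists_orthonormal_quadratic_le {ι : Type*} [Fintype ι] [DecidableEq ι]
    {M : Matrix ι ι ℝ} (hM : M.IsSymm) {ε L : ℝ} (hε : 0 < ε)
    (hL : ∀ x : ι → ℝ, ∑ a, ∑ b, M a b * x a * x b ≤ L * ∑ a, x a ^ 2) :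
    ∃ (S : Finset ι) (u : S → ι → ℝ),
      S.card * ε ^ 2 ≤ ∑ a, ∑ b, M a b ^ 2 ∧
      (∀ z : S → ℝ, ∑ a, (∑ l, z l * u l a) ^ 2 = ∑ l, z l ^ 2) ∧
      ∀ x : ι → ℝ, ∑ a, ∑ b, M a b * x a * x b
        ≤ ε * ∑ a, x a ^ 2 + L * ∑ l, (∑ a, u l a * x a) ^ 2 := by
  have hH : M.IsHermitian := by
    rw [Matrix.IsHermitian, Matrix.conjTranspose_eq_transpose_of_trivial]; exact hM
  set B := hH.eigenvectorBasis with hB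
  set ev := hH.eigenvalues with hev
  have heig : ∀ l a, ∑ b, M a b * B l b = ev l * B l a := fun l a => by
    have := congrFun (hH.mulVec_eigenvectorBasis l) a
    simpa [Matrix.mulVec, dotProduct] using this
  have hinner : ∀ x y : EuclideanSpace ℝ ι, inner ℝ x y = ∑ a, x a * y a := fun x y => by
    simp [PiLp.inner_apply, mul_comm]
  have hpars : ∀ x : ι → ℝ, ∑ l, (∑ a, B l a * x a) ^ 2 = ∑ a, x a ^ 2 := fun x => by
    have := B.sum_sq_inner_right (WithLp.toLp 2 x)
    rw [EuclideanSpace.real_norm_sq_eq] at this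
    simpa [hinner] using this
  have hquad : ∀ x : ι → ℝ, ∑ a, ∑ b, M a b * x a * x b
      = ∑ l, ev l * (∑ a, B l a * x a) ^ 2 := fun x => by
    have := B.sum_inner_mul_inner (WithLp.toLp 2 x) (WithLp.toLp 2 (M.mulVec x))
    rw [hinner (WithLp.toLp 2 x)] at this
    calc ∑ a, ∑ b, M a b * x a * x b = ∑ a, x a * M.mulVec x a := by
          refine Finset.sum_congr rfl fun a _ => ?_
          rw [Matrix.mulVec, dotProduct, Finset.mul_sum]
          exact Finset.sum_congr rfl fun b _ => by ring
      _ = _ := this.symm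
      _ = _ := by
          refine Finset.sum_congr rfl fun l _ => ?_
          have h1 : inner ℝ (B l) (WithLp.toLp 2 (M.mulVec x)) = ev l * ∑ a, B l a * x a := by
            rw [hinner]
            simp only [Matrix.mulVec, dotProduct, Finset.mul_sum]
            rw [Finset.sum_comm]
            refine Finset.sum_congr rfl fun b _ => ?_
            rw [← mul_assoc, ← heig, Finset.sum_mul]
            refine Finset.sum_congr rfl fun a _ => ?_
            rw [← hM.apply a b]; ring
          rw [h1, real_inner_comm, hinner]
          ring
  have hnorm : ∀ l, ∑ a, B l a ^ 2 = 1 := fun l => by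
    rw [← EuclideanSpace.real_norm_sq_eq, B.norm_eq_one, one_pow]
  have horth : ∀ l m, ∑ a, B l a * B m a = if l = m then 1 else 0 := fun l m => by
    rw [← hinner]
    exact orthonormal_iff_ite.1 B.orthonormal l m
  have hevL : ∀ l, ev l ≤ L := fun l => by
    have h1 := hL (B l)
    rw [hnorm, mul_one] at h1
    refine le_trans (le_of_eq ?_) h1
    rw [hquad]
    simp [horth]
  refine ⟨Finset.univ.filter fun l => ε < ev l, fun l => B l, ?_, fun z => ?_, fun x => ?_⟩
  · have hfrob : ∑ l, ev l ^ 2 = ∑ a, ∑ b, M a b ^ 2 := by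
      calc ∑ l, ev l ^ 2 = ∑ l, ∑ a, (∑ b, M a b * B l b) ^ 2 := by
            refine Finset.sum_congr rfl fun l _ => ?_
            simp only [heig, mul_pow, ← Finset.mul_sum, hnorm, mul_one]
        _ = _ := by
            rw [Finset.sum_comm]
            refine Finset.sum_congr rfl fun a _ => ?_
            rw [← hpars fun b => M a b]
            simp only [mul_comm]
    rw [← hfrob, ← nsmul_eq_mul, ← Finset.sum_const]
    calc _ ≤ ∑ l ∈ Finset.univ.filter fun l => ε < ev l, ev l ^ 2 := by
          refine Finset.sum_le_sum fun l hl => ?_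
          have := (Finset.mem_filter.1 hl).2
          gcongr
      _ ≤ _ := Finset.sum_le_sum_of_subset_of_nonneg (Finset.filter_subset _ _)
          fun l _ _ => sq_nonneg _
  · have h1 : ∀ a, (∑ l, z l * B l a) ^ 2 = ∑ l, ∑ m, z l * z m * (B l a * B m a) := fun a => by
      rw [sq, Finset.sum_mul_sum]
      exact Finset.sum_congr rfl fun l _ => Finset.sum_congr rfl fun m _ => by ring
    simp only [h1]
    rw [Finset.sum_comm]
    refine Finset.sum_congr rfl fun l _ => ?_
    rw [Finset.sum_comm]
    simp only [← Finset.mul_sum, horth, Subtype.val_inj]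
    simp [sq]
  · rw [hquad, ← hpars x, Finset.mul_sum,
      Finset.sum_coe_sort (Finset.univ.filter fun l => ε < ev l)
        (fun l => (∑ a, B l a * x a) ^ 2), Finset.sum_filter, Finset.mul_sum,
      ← Finset.sum_add_distrib]
    refine Finset.sum_le_sum fun l _ => ?_
    have hs := sq_nonneg (∑ a, B l a * x a)
    split_ifs with hl
    · nlinarith [mul_le_mul_of_nonneg_right (hevL l) hs, mul_nonneg hε.le hs]
    · nlinarith [mul_le_mul_of_nonneg_right (not_lt.1 hl) hs]

lemma quadratic_le_of_row_sum_le {ι : Type*} [Fintype ι] {M : Matrix ι ι ℝ} (hM : M.IsSymm)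
    (h0 : ∀ a b, 0 ≤ M a b) {L : ℝ} (hL : ∀ a, ∑ b, M a b ≤ L) (x : ι → ℝ) :
    ∑ a, ∑ b, M a b * x a * x b ≤ L * ∑ a, x a ^ 2 := by
  have h1 : ∑ a, ∑ b, M a b * x b ^ 2 = ∑ a, ∑ b, M a b * x a ^ 2 := by
    rw [Finset.sum_comm]
    exact Finset.sum_congr rfl fun a _ => Finset.sum_congr rfl fun b _ => by rw [hM.apply]
  have h2 : ∑ a, ∑ b, M a b * x a ^ 2 ≤ L * ∑ a, x a ^ 2 := by
    rw [Finset.mul_sum]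
    refine Finset.sum_le_sum fun a _ => ?_
    rw [← Finset.sum_mul]
    exact mul_le_mul_of_nonneg_right (hL a) (sq_nonneg _)
  have h3 : ∑ a, ∑ b, M a b * x a * x b
      ≤ ∑ a, ∑ b, (M a b * x a ^ 2 / 2 + M a b * x b ^ 2 / 2) :=
    Finset.sum_le_sum fun a _ => Finset.sum_le_sum fun b _ => by
      nlinarith [mul_nonneg (h0 a b) (sq_nonneg (x a - x b))]
  simp only [Finset.sum_add_distrib, ← Finset.sum_div] at h3
  linarith

lemma pottsH_smul_one {n q : ℕ} (A : Matrix (Fin n) (Fin n) ℝ) (β : ℝ) (h : Fin q → ℝ)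
    (y : Fin n → Fin q) :
    pottsH A (β • (1 : Matrix (Fin q) (Fin q) ℝ)) h y
      = β / 2 * ∑ i, ∑ j, A i j * (if y i = y j then 1 else 0) + ∑ i, h (y i) := by
  simp only [pottsH, Matrix.smul_apply, Matrix.one_apply, smul_eq_mul, Finset.mul_sum]
  congr 1
  exact Finset.sum_congr rfl fun i _ => Finset.sum_congr rfl fun j _ => by ring

lemma sum_prod_mul_apply {n q : ℕ} {θ : Fin q → ℝ} (hθ : probVec θ) (f : Fin q → ℝ)
    (i : Fin n) : ∑ y : Fin n → Fin q, (∏ k, θ (y k)) * f (y i) = ∑ r, θ r * f r := by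
  have h1 : ∀ y : Fin n → Fin q, (∏ k, θ (y k)) * f (y i)
      = ∏ k, (θ (y k) * if k = i then f (y k) else 1) := fun y => by
    rw [Finset.prod_mul_distrib, Finset.prod_ite_eq' Finset.univ i (fun k => f (y k))]
    simp
  simp only [h1]
  rw [← Fintype.prod_sum fun k r => θ r * if k = i then f r else 1]
  rw [Finset.prod_eq_single i]
  · simp
  · intro k _ hk
    simp [hk, hθ.2]
  · simp

lemma sum_prod_eq_one {n q : ℕ} {θ : Fin q → ℝ} (hθ : probVec θ) :
    ∑ y : Fin n → Fin q, ∏ k, θ (y k) = 1 := by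
  rw [← Fintype.prod_sum fun (_ : Fin n) r => θ r]
  simp [hθ.2]

lemma sum_prod_mul_ite_eq {n q : ℕ} {θ : Fin q → ℝ} (hθ : probVec θ) {i j : Fin n}
    (hij : i ≠ j) :
    ∑ y : Fin n → Fin q, (∏ k, θ (y k)) * (if y i = y j then 1 else 0) = ∑ r, θ r ^ 2 := by
  have h1 : ∀ y : Fin n → Fin q, (∏ k, θ (y k)) * (if y i = y j then (1 : ℝ) else 0)
      = ∑ r, ∏ k, (θ (y k) * (if k = i then if y k = r then 1 else 0 else 1)
          * (if k = j then if y k = r then 1 else 0 else 1)) := fun y => by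
    simp only [Finset.prod_mul_distrib]
    simp only [Finset.prod_ite_eq', Finset.mem_univ, if_true, mul_assoc, ← Finset.mul_sum]
    congr 1
    simp [eq_comm]
  simp only [h1]
  rw [Finset.sum_comm]
  refine Finset.sum_congr rfl fun r _ => ?_
  rw [← Fintype.prod_sum fun k s => θ s * (if k = i then if s = r then 1 else 0 else 1)
          * (if k = j then if s = r then 1 else 0 else 1)]
  have h2 : ∀ k, ∑ s, θ s * (if k = i then if s = r then (1 : ℝ) else 0 else 1)
          * (if k = j then if s = r then 1 else 0 else 1)
      = (if k = i then θ r else 1) * (if k = j then θ r else 1) := fun k => by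
    by_cases hi : k = i
    · have hj : k ≠ j := fun hj => hij (hi.symm.trans hj)
      simp [hi, hij]
    · by_cases hj : k = j
      · simp [hj, hij.symm]
      · simp [hi, hj, hθ.2]
  simp only [h2, Finset.prod_mul_distrib]
  simp [sq]

lemma sum_sum_sub_restrict_le {n : ℕ} {A : Matrix (Fin n) (Fin n) ℝ} (hA : A.IsSymm)
    (h0 : ∀ i j, 0 ≤ A i j) (G : Finset (Fin n)) (w : Fin n → Fin n → ℝ)
    (hw1 : ∀ i j, w i j ≤ 1) :
    ∑ i, ∑ j, A i j * w i j ≤ ∑ i, ∑ j, (if i ∈ G ∧ j ∈ G then A i j else 0) * w i j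
      + 2 * ∑ i ∈ Gᶜ, ∑ j, A i j := by
  have h1 : ∑ i ∈ Gᶜ, ∑ j, A i j = ∑ i, ∑ j, if i ∈ G then 0 else A i j := by
    rw [← Finset.sum_filter_add_sum_filter_not Finset.univ (· ∈ G)
      (fun i => ∑ j, if i ∈ G then 0 else A i j)]
    rw [Finset.sum_eq_zero (s := Finset.univ.filter (· ∈ G)), zero_add]
    · refine Finset.sum_congr (by ext; simp) fun i hi => ?_
      simp only [Finset.mem_filter] at hi
      simp [hi.2]
    · intro i hi
      simp only [Finset.mem_filter] at hi
      simp [hi.2]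
  have h2 : ∑ i ∈ Gᶜ, ∑ j, A i j = ∑ i, ∑ j, if j ∈ G then 0 else A i j := by
    rw [h1, Finset.sum_comm]
    exact Finset.sum_congr rfl fun a _ => Finset.sum_congr rfl fun b _ => by rw [hA.apply]
  rw [two_mul]
  nth_rewrite 1 [h1]
  rw [h2]
  simp only [← Finset.sum_add_distrib]
  refine Finset.sum_le_sum fun i _ => Finset.sum_le_sum fun j _ => ?_
  have h3 : A i j * w i j ≤ A i j := mul_le_of_le_one_right (h0 i j) (hw1 i j)
  have h4 := h0 i j
  by_cases hi : i ∈ G <;> by_cases hj : j ∈ G <;> simp [hi, hj] <;> linarith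

lemma le_pottsPhi {n q : ℕ} {A : Matrix (Fin n) (Fin n) ℝ} (h0 : ∀ i j, 0 ≤ A i j) {β : ℝ}
    (hβ : 0 ≤ β) (h : Fin q → ℝ) {θ : Fin q → ℝ} (hθ : probVec θ) :
    β / 2 * (∑ r, θ r ^ 2) * (∑ i, ∑ j, A i j)
        + n * (∑ r, h r * θ r - ∑ r, θ r * Real.log (θ r))
      ≤ pottsPhi A (β • (1 : Matrix (Fin q) (Fin q) ℝ)) h := by
  set H := pottsH A (β • (1 : Matrix (Fin q) (Fin q) ℝ)) h with hH
  set μ : (Fin n → Fin q) → ℝ := fun y => ∏ k, θ (y k) with hμ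
  have hμ0 : ∀ y, 0 ≤ μ y := fun y => Finset.prod_nonneg fun k _ => hθ.1 _
  have hμ1 : ∑ y, μ y = 1 := sum_prod_eq_one hθ
  set g : (Fin n → Fin q) → ℝ := fun y => H y - ∑ i, Real.log (θ (y i)) with hg
  have hjensen : exp (∑ y, μ y * g y) ≤ ∑ y, μ y * exp (g y) := by
    simpa using convexOn_exp.map_sum_le (t := Finset.univ) (w := μ) (p := g)
      (fun y _ => hμ0 y) hμ1 (fun y _ => Set.mem_univ _)
  have hle : ∀ y, μ y * exp (g y) ≤ exp (H y) := fun y => by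
    by_cases hy : ∀ k, 0 < θ (y k)
    · have : μ y = exp (∑ i, Real.log (θ (y i))) := by
        rw [exp_sum]
        exact Finset.prod_congr rfl fun k _ => (exp_log (hy k)).symm
      rw [this, ← exp_add, hg]
      simp
    · push Not at hy
      obtain ⟨k, hk⟩ := hy
      have : μ y = 0 := Finset.prod_eq_zero (Finset.mem_univ k) (le_antisymm hk (hθ.1 _))
      rw [this, zero_mul]
      exact (exp_pos _).le
  have hmean : β / 2 * (∑ r, θ r ^ 2) * (∑ i, ∑ j, A i j)
        + n * (∑ r, h r * θ r - ∑ r, θ r * Real.log (θ r)) ≤ ∑ y, μ y * g y := by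
    have hsite : ∀ f : Fin q → ℝ, ∑ y, μ y * ∑ i, f (y i) = n * ∑ r, θ r * f r := fun f => by
      simp only [Finset.mul_sum]
      rw [Finset.sum_comm]
      simp only [hμ, sum_prod_mul_apply hθ f]
      simp [Finset.mul_sum]
    have hpair : ∑ y, μ y * (β / 2 * ∑ i, ∑ j, A i j * (if y i = y j then 1 else 0))
        = β / 2 * ∑ i, ∑ j, A i j * ∑ y, μ y * (if y i = y j then 1 else 0) := by
      simp only [Finset.mul_sum]
      rw [Finset.sum_comm]
      refine Finset.sum_congr rfl fun i _ => ?_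
      rw [Finset.sum_comm]
      exact Finset.sum_congr rfl fun j _ => Finset.sum_congr rfl fun y _ => by ring
    have hdist : ∑ y, μ y * g y
        = ∑ y, μ y * (β / 2 * ∑ i, ∑ j, A i j * (if y i = y j then 1 else 0))
          + ∑ y, μ y * ∑ i, h (y i) - ∑ y, μ y * ∑ i, Real.log (θ (y i)) := by
      rw [← Finset.sum_add_distrib, ← Finset.sum_sub_distrib]
      refine Finset.sum_congr rfl fun y _ => ?_
      simp only [hg, hH, pottsH_smul_one]
      ring
    rw [hdist, hpair, hsite h, hsite fun r => Real.log (θ r)]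
    have hcorr : (∑ r, θ r ^ 2) * ∑ i, ∑ j, A i j
        ≤ ∑ i, ∑ j, A i j * ∑ y, μ y * (if y i = y j then 1 else 0) := by
      rw [Finset.mul_sum]
      refine Finset.sum_le_sum fun i _ => ?_
      rw [Finset.mul_sum]
      refine Finset.sum_le_sum fun j _ => ?_
      rw [mul_comm]
      refine mul_le_mul_of_nonneg_left ?_ (h0 i j)
      by_cases hij : i = j
      · simpa [hij, hμ1] using hθ.sum_sq_le_one
      · exact (sum_prod_mul_ite_eq hθ hij).ge
    have := mul_le_mul_of_nonneg_left hcorr (by linarith : 0 ≤ β / 2)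
    simp only [mul_comm (h _)]
    linarith
  rw [pottsPhi, Real.le_log_iff_exp_le
    (lt_of_lt_of_le (exp_pos _) (hjensen.trans (Finset.sum_le_sum fun y _ => hle y)))]
  exact (exp_le_exp.2 hmean).trans (hjensen.trans (Finset.sum_le_sum fun y _ => hle y))

lemma pottsPhi_le {n q : ℕ} (hq : 0 < q) {A : Matrix (Fin n) (Fin n) ℝ} (hA : A.IsSymm)
    (h0 : ∀ i j, 0 ≤ A i j) {β : ℝ} (hβ : 0 ≤ β) (h : Fin q → ℝ) {δ : ℝ} (hδ : 0 < δ)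
    (G : Finset (Fin n)) (hG : ∀ i ∈ G, ∑ j, A i j ≤ 1 + δ) :
    pottsPhi A (β • (1 : Matrix (Fin q) (Fin q) ℝ)) h
      ≤ n * curieWeissSup q (β * (1 + δ) + 2 * δ) h + β * ∑ i ∈ Gᶜ, ∑ j, A i j
        + β / 2 * δ * n
        + q * (∑ i, ∑ j, A i j ^ 2) / δ ^ 2 / 2 * Real.log ((β * (1 + δ) + 2 * δ) / δ) := by
  set A' : Matrix (Fin n) (Fin n) ℝ := fun i j => if i ∈ G ∧ j ∈ G then A i j else 0 with hA'
  set M : Matrix (Fin n × Fin q) (Fin n × Fin q) ℝ :=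
    fun a b => if a.2 = b.2 then A' a.1 b.1 else 0 with hM
  have hA'0 : ∀ i j, 0 ≤ A' i j := fun i j => by
    simp only [hA']; split_ifs; exacts [h0 i j, le_rfl]
  have hA'le : ∀ i j, A' i j ≤ A i j := fun i j => by
    simp only [hA']; split_ifs; exacts [le_rfl, h0 i j]
  have hMsymm : M.IsSymm := by
    refine Matrix.IsSymm.ext fun a b => ?_
    simp only [hM, hA', hA.apply a.1 b.1, eq_comm (a := b.2) (b := a.2),
      and_comm (a := b.1 ∈ G) (b := a.1 ∈ G)]
  have hM0 : ∀ a b, 0 ≤ M a b := fun a b => by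
    simp only [hM]; split_ifs; exacts [hA'0 _ _, le_rfl]
  have hrow : ∀ a, ∑ b, M a b ≤ 1 + δ := fun a => by
    have : ∑ b, M a b = ∑ j, A' a.1 j := by
      rw [Fintype.sum_prod_type]
      simp [hM]
    rw [this]
    by_cases ha : a.1 ∈ G
    · exact (Finset.sum_le_sum fun j _ => hA'le _ _).trans (hG _ ha)
    · have : ∑ j, A' a.1 j = 0 := by simp [hA', ha]
      linarith
  obtain ⟨S, u, hcard, hu, hquad⟩ := exists_orthonormal_quadratic_le hMsymm hδ
    (quadratic_le_of_row_sum_le hMsymm hM0 hrow)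
  have hfrob : ∑ a, ∑ b, M a b ^ 2 ≤ q * ∑ i, ∑ j, A i j ^ 2 := by
    have h1 : ∑ a, ∑ b, M a b ^ 2 = q * ∑ i, ∑ j, A' i j ^ 2 := by
      simp only [Fintype.sum_prod_type, hM, ite_pow]
      simp [Finset.mul_sum]
    rw [h1]
    gcongr with i _ j _
    exacts [hA'0 _ _, hA'le _ _]
  set b : ℝ := β * (1 + δ) + δ with hb
  set b' : ℝ := β * (1 + δ) + 2 * δ with hb'
  have hbpos : 0 < b := by positivity
  have hbb : b < b' := by rw [hb, hb']; linarith
  have hdiff : b' - b = δ := by rw [hb, hb']; ring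
  have hH : ∀ y : Fin n → Fin q, pottsH A (β • (1 : Matrix (Fin q) (Fin q) ℝ)) h y
      ≤ (β * ∑ i ∈ Gᶜ, ∑ j, A i j + β / 2 * δ * n)
        + (b / 2 * ∑ l, (∑ i, u l (i, y i)) ^ 2 + ∑ i, h (y i)) := fun y => by
    rw [pottsH_smul_one]
    have h1 := sum_sum_sub_restrict_le hA h0 G (fun i j => if y i = y j then 1 else 0)
      (fun i j => by split_ifs <;> norm_num)
    have h2 := hquad fun a => if y a.1 = a.2 then 1 else 0
    have h3 : ∑ a : Fin n × Fin q, ∑ b : Fin n × Fin q,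
          M a b * (if y a.1 = a.2 then 1 else 0) * (if y b.1 = b.2 then 1 else 0)
        = ∑ i, ∑ j, A' i j * (if y i = y j then 1 else 0) := by
      simp [Fintype.sum_prod_type, hM]
    have h4 : ∑ a : Fin n × Fin q, (if y a.1 = a.2 then (1 : ℝ) else 0) ^ 2 = n := by
      rw [Fintype.sum_prod_type]
      simp
    have h5 : ∀ l, ∑ a : Fin n × Fin q, u l a * (if y a.1 = a.2 then (1 : ℝ) else 0)
        = ∑ i, u l (i, y i) := fun l => by
      simp [Fintype.sum_prod_type]
    rw [h3, h4] at h2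
    simp only [h5] at h2
    have h6 : 0 ≤ ∑ l, (∑ i, u l (i, y i)) ^ 2 := Finset.sum_nonneg fun l _ => sq_nonneg _
    have h7 := mul_le_mul_of_nonneg_left (h1.trans (add_le_add_left h2 _))
      (by linarith : 0 ≤ β / 2)
    rw [hb]
    nlinarith [mul_nonneg hδ.le h6]
  have : Nonempty (Fin q) := ⟨⟨0, hq⟩⟩
  rw [pottsPhi, Real.log_le_iff_le_exp
    (Finset.sum_pos (fun y _ => exp_pos _) Finset.univ_nonempty)]
  have hratio : 1 ≤ b' / δ := by
    rw [one_le_div hδ, ← hdiff]; linarith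
  have hpow : (b' / (b' - b)) ^ (Fintype.card S / 2 : ℝ)
      ≤ exp (q * (∑ i, ∑ j, A i j ^ 2) / δ ^ 2 / 2 * Real.log (b' / δ)) := by
    rw [hdiff, Real.rpow_def_of_pos (by linarith), mul_comm, Fintype.card_coe]
    gcongr
    · exact Real.log_nonneg hratio
    · rw [le_div_iff₀ (by positivity)]
      exact hcard.trans hfrob
  calc ∑ y, exp (pottsH A (β • (1 : Matrix (Fin q) (Fin q) ℝ)) h y)
      ≤ ∑ y : Fin n → Fin q, exp (β * ∑ i ∈ Gᶜ, ∑ j, A i j + β / 2 * δ * n)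
        * exp (b / 2 * ∑ l, (∑ i, u l (i, y i)) ^ 2 + ∑ i, h (y i)) :=
        Finset.sum_le_sum fun y _ => by
          rw [← exp_add]; exact exp_le_exp.2 (hH y)
    _ ≤ exp (β * ∑ i ∈ Gᶜ, ∑ j, A i j + β / 2 * δ * n)
        * ((b' / (b' - b)) ^ (Fintype.card S / 2 : ℝ) * exp (n * curieWeissSup q b' h)) := by
        rw [← Finset.mul_sum]
        gcongr
        exact sum_exp_projection_le hq u hu h hbpos hbb
    _ ≤ exp (β * ∑ i ∈ Gᶜ, ∑ j, A i j + β / 2 * δ * n)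
        * (exp (q * (∑ i, ∑ j, A i j ^ 2) / δ ^ 2 / 2 * Real.log (b' / δ))
          * exp (n * curieWeissSup q b' h)) := by gcongr
    _ = _ := by
        rw [← exp_add, ← exp_add]
        congr 1
        ring

theorem asymp_regular_limit (q : ℕ) (hq : 2 ≤ q) (β : ℝ) (hβ : 0 ≤ β) (h : Fin q → ℝ)
    (A : (n : ℕ) → Matrix (Fin n) (Fin n) ℝ) (hsymm : ∀ n, (A n).IsSymm)
    (hreg : asympRegular A) :
    Tendsto
      (fun n : ℕ => pottsPhi (A n) (β • (1 : Matrix (Fin q) (Fin q) ℝ)) h / n)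
      atTop (nhds (curieWeissSup q β h)) := by
  classical
  obtain ⟨⟨-, htr⟩, h0, hbad, hsum⟩ := hreg
  have hq0 : 0 < q := by omega
  rw [tendsto_order]
  constructor
  · intro a ha
    have hlim : Tendsto (fun n : ℕ => curieWeissSup q β h
        - β / 2 * |(∑ i, ∑ j, A n i j) / n - 1|) atTop (nhds (curieWeissSup q β h)) := by
      have := (((hsum.sub_const 1).abs).const_mul (β / 2)).const_sub (curieWeissSup q β h)
      simpa using this
    filter_upwards [hlim.eventually_const_lt ha, eventually_gt_atTop 0] with n hn hn0
    have hnR : (0 : ℝ) < n := by exact_mod_cast hn0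
    refine hn.trans_le ?_
    rw [sub_le_iff_le_add]
    refine curieWeissSup_le hq0 fun θ hθ => ?_
    have h1 := div_le_div_of_nonneg_right (le_pottsPhi (h0 n) hβ h hθ) hnR.le
    set s := (∑ i, ∑ j, A n i j) / (n : ℝ) with hs
    have h2 : (β / 2 * (∑ r, θ r ^ 2) * (∑ i, ∑ j, A n i j)
        + n * (∑ r, h r * θ r - ∑ r, θ r * Real.log (θ r))) / n
        = β / 2 * (∑ r, θ r ^ 2) * s + (∑ r, h r * θ r - ∑ r, θ r * Real.log (θ r)) := by
      rw [hs]; field_simp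
    rw [h2] at h1
    have h3 : 0 ≤ ∑ r, θ r ^ 2 := Finset.sum_nonneg fun r _ => sq_nonneg _
    have h4 : β / 2 * ((∑ r, θ r ^ 2) * (1 - s)) ≤ β / 2 * |s - 1| := by
      refine mul_le_mul_of_nonneg_left ?_ (by linarith)
      calc (∑ r, θ r ^ 2) * (1 - s) ≤ (∑ r, θ r ^ 2) * |s - 1| := by
            gcongr; rw [abs_sub_comm]; exact le_abs_self _
        _ ≤ 1 * |s - 1| := by gcongr; exact hθ.sum_sq_le_one
        _ = _ := one_mul _
    linarith
  · intro a ha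
    set δ : ℝ := (a - curieWeissSup q β h) / (4 * β + 3) with hδdef
    have hδ : 0 < δ := div_pos (sub_pos.2 ha) (by linarith)
    have hδa : δ * (4 * β + 3) = a - curieWeissSup q β h :=
      div_mul_cancel₀ _ (by linarith)
    set c : ℝ := q / δ ^ 2 / 2 * Real.log ((β * (1 + δ) + 2 * δ) / δ) with hc
    have hlow : Tendsto (fun n : ℕ => Matrix.trace (A n * A n) / n * c) atTop (nhds 0) := by
      simpa using htr.mul_const c
    filter_upwards [hlow.eventually_lt_const hδ, (hbad δ hδ).eventually_lt_const hδ,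
      hsum.eventually_lt_const (by linarith : (1 : ℝ) < 1 + δ), eventually_gt_atTop 0]
      with n hn1 hn2 hn3 hn0
    have hnR : (0 : ℝ) < n := by exact_mod_cast hn0
    set G : Finset (Fin n) := Finset.univ.filter fun i => |(∑ j, A n i j) - 1| ≤ δ with hG
    have hGc : Gᶜ = Finset.univ.filter fun i : Fin n => δ < |(∑ j, A n i j) - 1| := by
      ext i; simp [hG]
    have hGmem : ∀ i ∈ G, |(∑ j, A n i j) - 1| ≤ δ := fun i hi => (Finset.mem_filter.1 hi).2
    have hmain := pottsPhi_le hq0 (hsymm n) (h0 n) hβ h hδ G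
      fun i hi => by linarith [(abs_le.1 (hGmem i hi)).2]
    have htrace : Matrix.trace (A n * A n) = ∑ i, ∑ j, A n i j ^ 2 := by
      simp only [Matrix.trace, Matrix.diag_apply, Matrix.mul_apply]
      refine Finset.sum_congr rfl fun i _ => Finset.sum_congr rfl fun j _ => ?_
      rw [(hsymm n).apply i j, sq]
    rw [← htrace] at hmain
    rw [div_lt_iff₀ hnR] at hn2 hn3
    have hcardG : (G.card : ℝ) + (Gᶜ.card : ℝ) = n := by
      exact_mod_cast (by simp : G.card + Gᶜ.card = n)
    rw [← hGc] at hn2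
    have hgood : (G.card : ℝ) * (1 - δ) ≤ ∑ i ∈ G, ∑ j, A n i j := by
      rw [← nsmul_eq_mul, ← Finset.sum_const]
      exact Finset.sum_le_sum fun i hi => by linarith [(abs_le.1 (hGmem i hi)).1]
    have hsplit := Finset.sum_add_sum_compl G fun i => ∑ j, A n i j
    have hbadsum : ∑ i ∈ Gᶜ, ∑ j, A n i j ≤ 3 * δ * n := by
      have : 0 ≤ δ * (Gᶜ.card : ℝ) := by positivity
      have hcG : (G.card : ℝ) = n - Gᶜ.card := by linarith
      rw [hcG] at hgood
      nlinarith
    have hF : curieWeissSup q (β * (1 + δ) + 2 * δ) h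
        ≤ curieWeissSup q β h + (β * δ + 2 * δ) / 2 := by
      refine (curieWeissSup_le_add hq0 (β := β) (by nlinarith [mul_nonneg hβ hδ.le]) h).trans_eq ?_
      ring
    have h1 : q * Matrix.trace (A n * A n) / δ ^ 2 / 2
          * Real.log ((β * (1 + δ) + 2 * δ) / δ)
        = n * (Matrix.trace (A n * A n) / n * c) := by
      rw [hc]; field_simp
    rw [h1] at hmain
    rw [div_lt_iff₀ hnR]
    have h2 := mul_le_mul_of_nonneg_left hF hnR.le
    have h3 := mul_le_mul_of_nonneg_left hbadsum hβ
    have h4 := mul_lt_mul_of_pos_left hn1 hnR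
    have h5 : a = curieWeissSup q β h + δ * (4 * β + 3) := by linarith
    rw [h5]
    nlinarith [mul_pos hδ hnR]
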